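/- Let M be a spacelike surface in ℝ^{3,1} with a canonical normal null direction Z. Then the Gauss curvature of M is given by K = −Z^⊤(a) − a², where Z^⊤(a) denotes the derivative of the function a in the direction Z^⊤. -/

import Mathlib

noncomputable section

/-- Points of the parameter domain of the surface chart. -/
abbrev Pt : Type := ℝ × ℝ

/-- Vectors of the Minkowski space `ℝ^{3,1}`. -/
abbrev E4 : Type := Fin 4 → ℝ

/-- The Minkowski bilinear form of signature `(+,+,+,-)` on `ℝ⁴`. -/
def mink (v w : E4) : ℝ := v 0 * w 0 + v 1 * w 1 + v 2 * w 2 - v 3 * w 3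

/-- Realization in `ℝ^{3,1}` of a coordinate vector field `X` along the immersion `ψ`. -/
def vecF (ψ : Pt → E4) (X : Pt → Pt) : Pt → E4 := fun p => fderiv ℝ ψ p (X p)

/-- Flat (ambient) derivative of an `ℝ⁴`-valued field along a coordinate vector field. -/
def Dflat (X : Pt → Pt) (V : Pt → E4) : Pt → E4 := fun p => fderiv ℝ V p (X p)

/-- Second fundamental form `B(X,Y) = ∇̄_X Y − ∇_X Y`. -/
def sff (ψ : Pt → E4) (conn : (Pt → Pt) → (Pt → Pt) → Pt → Pt) (X Y : Pt → Pt) : Pt → E4 :=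
  fun p => Dflat X (vecF ψ Y) p - vecF ψ (conn X Y) p

/-- `v` is tangent to the surface at `p`. -/
def isTangentV (ψ : Pt → E4) (p : Pt) (v : E4) : Prop := ∃ w : Pt, fderiv ℝ ψ p w = v

/-- `v` is normal to the surface at `p`. -/
def isNormalV (ψ : Pt → E4) (p : Pt) (v : E4) : Prop := ∀ w : Pt, mink v (fderiv ℝ ψ p w) = 0

/-- Lie bracket of coordinate vector fields on the chart. -/
def lieB (X Y : Pt → Pt) : Pt → Pt := fun p => fderiv ℝ Y p (X p) - fderiv ℝ X p (Y p)

/-- Curvature tensor `R(X,Y)V = ∇_Y∇_X V − ∇_X∇_Y V + ∇_{[X,Y]}V`. -/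
def curvR (conn : (Pt → Pt) → (Pt → Pt) → Pt → Pt) (X Y V : Pt → Pt) : Pt → Pt :=
  fun p => conn Y (conn X V) p - conn X (conn Y V) p + conn (lieB X Y) V p

/-- Normal curvature tensor `R^⊥(X,Y)ν = ∇⊥_Y∇⊥_X ν − ∇⊥_X∇⊥_Y ν + ∇⊥_{[X,Y]}ν`. -/
def curvRperp (nconn : (Pt → Pt) → (Pt → E4) → Pt → E4) (X Y : Pt → Pt) (ν : Pt → E4) :
    Pt → E4 :=
  fun p => nconn Y (nconn X ν) p - nconn X (nconn Y ν) p + nconn (lieB X Y) ν p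

/-- Determinant of four vectors of `ℝ⁴` (the volume form `e₁∧e₂∧e₃∧e₄ ↦ 1`). -/
def det4 (a b c d : E4) : ℝ := Matrix.det (Matrix.of ![a, b, c, d])

/-- A spacelike surface in `ℝ^{3,1}`, given by a chart `ψ : U → ℝ^{3,1}`, endowed with a
canonical normal null direction with respect to the constant unit spacelike vector `Z`,
together with all the associated geometric data: the Levi-Civita connection `conn`,
the normal connection `nconn`, the tangent part `Z^⊤` (coordinates `ZT`), the oriented
orthonormal completion `W` (coordinates `Wc`), the shape operator `shA = A_{Z^⊥}`,
the 1-form `β` with `B(X,Z^⊤) = β(X)Z^⊥`, and the lightlike normal field `W'` with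
`⟨Z^⊥,W'⟩ = 1`.  Each piece of data is characterized by its defining property. -/
structure CNND where
  U : Set Pt
  hUopen : IsOpen U
  ψ : Pt → E4
  hψ : ContDiffOn ℝ (⊤ : ℕ∞) ψ U
  himm : ∀ p ∈ U, ∀ v : Pt, fderiv ℝ ψ p v = 0 → v = 0
  hspacelike : ∀ p ∈ U, ∀ v : Pt, v ≠ 0 → 0 < mink (fderiv ℝ ψ p v) (fderiv ℝ ψ p v)
  /-- Levi-Civita connection of the induced metric, as the tangent part of the flat one. -/
  conn : (Pt → Pt) → (Pt → Pt) → Pt → Pt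
  hconn : ∀ X Y, ∀ p ∈ U, DifferentiableAt ℝ (vecF ψ Y) p → isNormalV ψ p (sff ψ conn X Y p)
  hconnSmooth : ∀ X Y, ContDiffOn ℝ (⊤ : ℕ∞) X U → ContDiffOn ℝ (⊤ : ℕ∞) Y U → ContDiffOn ℝ (⊤ : ℕ∞) (conn X Y) U
  /-- Normal connection: the normal part of the flat derivative of a normal field. -/
  nconn : (Pt → Pt) → (Pt → E4) → Pt → E4
  hnconn : ∀ X ν, ∀ p ∈ U, (∀ q ∈ U, isNormalV ψ q (ν q)) → DifferentiableAt ℝ ν p →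
    isNormalV ψ p (nconn X ν p) ∧ isTangentV ψ p (Dflat X ν p - nconn X ν p)
  hnconnSmooth : ∀ X ν, ContDiffOn ℝ (⊤ : ℕ∞) X U → (∀ q ∈ U, isNormalV ψ q (ν q)) →
    ContDiffOn ℝ (⊤ : ℕ∞) ν U → ContDiffOn ℝ (⊤ : ℕ∞) (nconn X ν) U
  /-- The parallel (constant) vector field `Z`, a unit spacelike vector. -/
  Z : E4
  hZunit : mink Z Z = 1
  /-- Coordinates of the tangent part `Z^⊤` of `Z`; `Z^⊥ = Z − Z^⊤` is normal. -/
  ZT : Pt → Pt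
  hZTsmooth : ContDiffOn ℝ (⊤ : ℕ∞) ZT U
  hZTtangentpart : ∀ p ∈ U, isNormalV ψ p (Z - fderiv ℝ ψ p (ZT p))
  /-- canonical normal null direction: `Z^⊥` is lightlike … -/
  hZperpNull : ∀ p ∈ U, mink (Z - fderiv ℝ ψ p (ZT p)) (Z - fderiv ℝ ψ p (ZT p)) = 0
  /-- … and nowhere zero. -/
  hZperpNe : ∀ p ∈ U, Z - fderiv ℝ ψ p (ZT p) ≠ 0
  /-- Coordinates of the unit tangent field `W` orthogonal to `Z^⊤`, positively oriented. -/
  Wc : Pt → Pt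
  hWsmooth : ContDiffOn ℝ (⊤ : ℕ∞) Wc U
  hWunit : ∀ p ∈ U, mink (fderiv ℝ ψ p (Wc p)) (fderiv ℝ ψ p (Wc p)) = 1
  hWorth : ∀ p ∈ U, mink (fderiv ℝ ψ p (ZT p)) (fderiv ℝ ψ p (Wc p)) = 0
  hWorient : ∀ p ∈ U, 0 < (ZT p).1 * (Wc p).2 - (ZT p).2 * (Wc p).1
  /-- The shape operator `A_{Z^⊥}`: `⟨A_{Z^⊥}X, Y⟩ = ⟨B(X,Y), Z^⊥⟩`. -/
  shA : (Pt → Pt) → Pt → Pt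
  hshA : ∀ X Y, ∀ p ∈ U, DifferentiableAt ℝ (vecF ψ Y) p →
    mink (fderiv ℝ ψ p (shA X p)) (fderiv ℝ ψ p (Y p)) =
      mink (sff ψ conn X Y p) (Z - fderiv ℝ ψ p (ZT p))
  /-- The 1-form `β` with `B(X, Z^⊤) = β(X) Z^⊥`. -/
  beta : Pt → Pt → ℝ
  hbeta : ∀ X, ∀ p ∈ U, sff ψ conn X ZT p = beta p (X p) • (Z - fderiv ℝ ψ p (ZT p))
  /-- The lightlike normal field `W'` with `⟨Z^⊥, W'⟩ = 1`, such that
  `(Z^⊤, W, (Z^⊥+W')/√2, (Z^⊥−W')/√2)` is a positively oriented orthonormal frame. -/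
  Wp : Pt → E4
  hWpNormal : ∀ p ∈ U, isNormalV ψ p (Wp p)
  hWpNull : ∀ p ∈ U, mink (Wp p) (Wp p) = 0
  hWpPair : ∀ p ∈ U, mink (Z - fderiv ℝ ψ p (ZT p)) (Wp p) = 1
  hWpOrient : ∀ p ∈ U, 0 < det4 (fderiv ℝ ψ p (ZT p)) (fderiv ℝ ψ p (Wc p))
    ((Real.sqrt 2)⁻¹ • ((Z - fderiv ℝ ψ p (ZT p)) + Wp p))
    ((Real.sqrt 2)⁻¹ • ((Z - fderiv ℝ ψ p (ZT p)) - Wp p))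

namespace CNND

variable (S : CNND)

/-- The normal part `Z^⊥` of `Z` along the surface. -/
def Zperp : Pt → E4 := fun p => S.Z - fderiv ℝ S.ψ p (S.ZT p)

/-- The second fundamental form of the surface. -/
def B : (Pt → Pt) → (Pt → Pt) → Pt → E4 := sff S.ψ S.conn

/-- The function `a = α(W) = ⟨B(W,W), Z^⊥⟩`. -/
def afun : Pt → ℝ := fun p => mink (S.B S.Wc S.Wc p) (S.Zperp p)

/-- The 1-form `α(X) = ⟨B(X,W), Z^⊥⟩`. -/
def alphaF (X : Pt → Pt) : Pt → ℝ := fun p => mink (S.B X S.Wc p) (S.Zperp p)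

/-- The mean curvature vector `H⃗ = (1/2)(B(Z^⊤,Z^⊤) + B(W,W))`. -/
def Hvec : Pt → E4 := fun p => (1 / 2 : ℝ) • (S.B S.ZT S.ZT p + S.B S.Wc S.Wc p)

/-- The Gauss curvature `K = ⟨R(Z^⊤,W)Z^⊤, W⟩`. -/
def Kfun : Pt → ℝ := fun p =>
  mink (fderiv ℝ S.ψ p (curvR S.conn S.ZT S.Wc S.ZT p)) (fderiv ℝ S.ψ p (S.Wc p))

/-- The normal curvature `K_N = ⟨R^⊥(Z^⊤,W)Z^⊥, W'⟩`. -/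
def KNfun : Pt → ℝ := fun p => mink (curvRperp S.nconn S.ZT S.Wc S.Zperp p) (S.Wp p)

end CNND

/-- The wedge `v ∧ w` of two vectors of `ℝ⁴`, as an antisymmetric matrix (bivector). -/
def wedge2 (v w : E4) : Fin 4 → Fin 4 → ℝ := fun i j => v i * w j - v j * w i

/-- The Gauss map `G = Z^⊤ ∧ W : M → Λ²ℝ^{3,1}`. -/
def CNND.Gmap (S : CNND) : Pt → Fin 4 → Fin 4 → ℝ :=
  fun p => wedge2 (fderiv ℝ S.ψ p (S.ZT p)) (fderiv ℝ S.ψ p (S.Wc p))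

/-- The signs of the Minkowski metric. -/
def epsM : Fin 4 → ℝ := fun i => if i = 3 then -1 else 1

/-- The induced (signature `(3,3)`) inner product on bivectors of `ℝ^{3,1}`:
`⟨v∧w, v'∧w'⟩ = ⟨v,v'⟩⟨w,w'⟩ − ⟨v,w'⟩⟨w,v'⟩`. -/
def binner (η η' : Fin 4 → Fin 4 → ℝ) : ℝ :=
  (1 / 2) * ∑ i : Fin 4, ∑ j : Fin 4, epsM i * epsM j * η i j * η' i j

/-- The wedge product `Λ²ℝ^{3,1} × Λ²ℝ^{3,1} → Λ⁴ℝ^{3,1} ≅ ℝ`, normalized so that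
`(v∧w)∧(v'∧w') = det(v,w,v',w')`. -/
def bwedge (η η' : Fin 4 → Fin 4 → ℝ) : ℝ :=
  (1 / 4) * ∑ σ : Equiv.Perm (Fin 4),
    ((Equiv.Perm.sign σ : ℤ) : ℝ) * η (σ 0) (σ 1) * η' (σ 2) (σ 3)

/-- The `ℂ`-bilinear form `H(η,η') = ⟨η,η'⟩ + i η∧η'` on bivectors, where `i = −⋆`. -/
def HformC (η η' : Fin 4 → Fin 4 → ℝ) : ℂ :=
  (binner η η' : ℝ) + (bwedge η η' : ℝ) * Complex.I

/-- The quadratic form `δ(u) = dG(u) ∧ dG(u)` whose zero directions are the asymptotic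
directions. -/
def CNND.deltaQ (S : CNND) (p : Pt) (u : Pt) : ℝ :=
  bwedge (fderiv ℝ S.Gmap p u) (fderiv ℝ S.Gmap p u)

section Minkowski

theorem mink_comm (v w : E4) : mink v w = mink w v := by
  simp only [mink]; ring

theorem mink_add_left (u v w : E4) : mink (u + v) w = mink u w + mink v w := by
  simp only [mink, Pi.add_apply]; ring

theorem mink_sub_left (u v w : E4) : mink (u - v) w = mink u w - mink v w := by
  simp only [mink, Pi.sub_apply]; ring

theorem mink_smul_left (c : ℝ) (v w : E4) : mink (c • v) w = c * mink v w := by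
  simp only [mink, Pi.smul_apply, smul_eq_mul]; ring

theorem mink_sub_right (u v w : E4) : mink u (v - w) = mink u v - mink u w := by
  simp only [mink, Pi.sub_apply]; ring

theorem HasFDerivAt.mink {f g : Pt → E4} {f' g' : Pt →L[ℝ] E4} {p : Pt}
    (hf : HasFDerivAt f f' p) (hg : HasFDerivAt g g' p) :
    ∃ L : Pt →L[ℝ] ℝ, HasFDerivAt (fun q => mink (f q) (g q)) L p ∧
      ∀ v, L v = mink (f' v) (g p) + mink (f p) (g' v) := by
  have h := fun i => (hasFDerivAt_pi'.1 hf i).mul (hasFDerivAt_pi'.1 hg i)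
  refine ⟨_, (((h 0).add (h 1)).add (h 2)).sub (h 3), fun v => ?_⟩
  simp [_root_.mink]
  ring

theorem DifferentiableAt.mink {f g : Pt → E4} {p : Pt}
    (hf : DifferentiableAt ℝ f p) (hg : DifferentiableAt ℝ g p) :
    DifferentiableAt ℝ (fun q => mink (f q) (g q)) p :=
  let ⟨_, hL, _⟩ := hf.hasFDerivAt.mink hg.hasFDerivAt
  hL.differentiableAt

theorem fderiv_mink_apply {f g : Pt → E4} {p : Pt}
    (hf : DifferentiableAt ℝ f p) (hg : DifferentiableAt ℝ g p) (v : Pt) :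
    fderiv ℝ (fun q => mink (f q) (g q)) p v =
      mink (fderiv ℝ f p v) (g p) + mink (f p) (fderiv ℝ g p v) := by
  obtain ⟨L, hL, h⟩ := hf.hasFDerivAt.mink hg.hasFDerivAt
  rw [hL.fderiv, h]

/-- If `⟨f, g⟩` is constant on an open set, then `⟨Df, g⟩ + ⟨f, Dg⟩ = 0` there. -/
theorem mink_fderiv_add_eq_zero {U : Set Pt} (hU : IsOpen U) {f g : Pt → E4} {p : Pt} (hp : p ∈ U)
    (hf : DifferentiableAt ℝ f p) (hg : DifferentiableAt ℝ g p) {c : ℝ}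
    (h : ∀ q ∈ U, mink (f q) (g q) = c) (v : Pt) :
    mink (fderiv ℝ f p v) (g p) + mink (f p) (fderiv ℝ g p v) = 0 := by
  have hc : (fun q => mink (f q) (g q)) =ᶠ[nhds p] fun _ => c :=
    Filter.eventually_of_mem (hU.mem_nhds hp) h
  rw [← fderiv_mink_apply hf hg, hc.fderiv_eq]
  simp

end Minkowski

/-- The ambient derivatives of coordinate fields along an immersion are torsion-free:
`∇̄_X Y − ∇̄_Y X = dψ [X, Y]`. -/
theorem Dflat_vecF_sub_Dflat_vecF {ψ : Pt → E4} {X Y : Pt → Pt} {p : Pt}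
    (hψ : ContDiffAt ℝ 2 ψ p) (hX : DifferentiableAt ℝ X p) (hY : DifferentiableAt ℝ Y p) :
    Dflat X (vecF ψ Y) p - Dflat Y (vecF ψ X) p = fderiv ℝ ψ p (lieB X Y p) := by
  have hd : DifferentiableAt ℝ (fderiv ℝ ψ) p :=
    (hψ.fderiv_right (m := 1) (by norm_num)).differentiableAt (by norm_num)
  have hsymm : IsSymmSndFDerivAt ℝ ψ p := hψ.isSymmSndFDerivAt (by simp)
  have h1 : fderiv ℝ (vecF ψ Y) p = _ := fderiv_clm_apply hd hY
  have h2 : fderiv ℝ (vecF ψ X) p = _ := fderiv_clm_apply hd hX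
  simp only [Dflat, lieB, h1, h2]
  simp [hsymm.eq (X p) (Y p)]

theorem mink_vecF_conn {ψ : Pt → E4} {conn : (Pt → Pt) → (Pt → Pt) → Pt → Pt} {X Y : Pt → Pt}
    {p : Pt} (h : isNormalV ψ p (sff ψ conn X Y p)) (v : Pt) :
    mink (fderiv ℝ ψ p (conn X Y p)) (fderiv ℝ ψ p v) =
      mink (fderiv ℝ (vecF ψ Y) p (X p)) (fderiv ℝ ψ p v) := by
  have := h v
  simp only [sff, Dflat, mink_sub_left] at this
  simp only [vecF] at this ⊢
  linarith

namespace CNND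

variable (S : CNND)

theorem contDiffOn_vecF {X : Pt → Pt} (hX : ContDiffOn ℝ (⊤ : ℕ∞) X S.U) :
    ContDiffOn ℝ (⊤ : ℕ∞) (vecF S.ψ X) S.U :=
  (S.hψ.fderiv_of_isOpen S.hUopen (by simp)).clm_apply hX

theorem differentiableAt_of_contDiffOn {F : Type*} [NormedAddCommGroup F] [NormedSpace ℝ F]
    {f : Pt → F} (hf : ContDiffOn ℝ (⊤ : ℕ∞) f S.U) {p : Pt} (hp : p ∈ S.U) :
    DifferentiableAt ℝ f p :=
  (hf.contDiffAt (S.hUopen.mem_nhds hp)).differentiableAt (by simp)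

theorem differentiableAt_vecF_ZT {p : Pt} (hp : p ∈ S.U) :
    DifferentiableAt ℝ (vecF S.ψ S.ZT) p :=
  S.differentiableAt_of_contDiffOn (S.contDiffOn_vecF S.hZTsmooth) hp

theorem differentiableAt_vecF_Wc {p : Pt} (hp : p ∈ S.U) :
    DifferentiableAt ℝ (vecF S.ψ S.Wc) p :=
  S.differentiableAt_of_contDiffOn (S.contDiffOn_vecF S.hWsmooth) hp

section

variable {p : Pt} (hp : p ∈ S.U)
include hp

theorem mink_Z (v : Pt) :
    mink S.Z (fderiv ℝ S.ψ p v) = mink (vecF S.ψ S.ZT p) (fderiv ℝ S.ψ p v) := by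
  have := S.hZTtangentpart p hp v
  rw [mink_sub_left] at this
  simp only [vecF]
  linarith

theorem mink_ZT_ZT : mink (vecF S.ψ S.ZT p) (vecF S.ψ S.ZT p) = 1 := by
  have h1 := S.mink_Z hp (S.ZT p)
  have h2 := S.hZperpNull p hp
  have h3 := S.hZTtangentpart p hp (S.ZT p)
  rw [mink_sub_right, h3, mink_sub_left, S.hZunit, mink_comm _ S.Z, h1] at h2
  simp only [vecF] at h2 ⊢
  linarith

theorem exists_eq_smul_add_smul (v : Pt) : ∃ x y : ℝ, v = x • S.ZT p + y • S.Wc p := by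
  have h := (S.hWorient p hp).ne'
  refine ⟨(v.1 * (S.Wc p).2 - v.2 * (S.Wc p).1) /
      ((S.ZT p).1 * (S.Wc p).2 - (S.ZT p).2 * (S.Wc p).1),
    ((S.ZT p).1 * v.2 - (S.ZT p).2 * v.1) /
      ((S.ZT p).1 * (S.Wc p).2 - (S.ZT p).2 * (S.Wc p).1), ?_⟩
  ext
  · simp only [Prod.fst_add, Prod.smul_fst, smul_eq_mul]
    rw [div_mul_eq_mul_div, div_mul_eq_mul_div, ← add_div, eq_div_iff h]
    ring
  · simp only [Prod.snd_add, Prod.smul_snd, smul_eq_mul]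
    rw [div_mul_eq_mul_div, div_mul_eq_mul_div, ← add_div, eq_div_iff h]
    ring

/-- Expansion of a tangent vector in the orthonormal frame `(Z^⊤, W)`. -/
theorem eq_mink_smul_add_mink_smul (v : Pt) :
    v = mink (fderiv ℝ S.ψ p v) (vecF S.ψ S.ZT p) • S.ZT p +
      mink (fderiv ℝ S.ψ p v) (vecF S.ψ S.Wc p) • S.Wc p := by
  obtain ⟨x, y, rfl⟩ := S.exists_eq_smul_add_smul hp v
  have h1 := S.mink_ZT_ZT hp
  have h2 := S.hWunit p hp
  have h3 := S.hWorth p hp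
  have h4 := h3
  rw [mink_comm] at h4
  simp only [vecF] at h1 ⊢
  simp only [map_add, map_smul, mink_add_left, mink_smul_left, h1, h2, h3, h4]
  simp

theorem mink_fderiv_ZT_ZT (v : Pt) :
    mink (fderiv ℝ (vecF S.ψ S.ZT) p v) (vecF S.ψ S.ZT p) = 0 := by
  have hd := S.differentiableAt_vecF_ZT hp
  have h := mink_fderiv_add_eq_zero S.hUopen hp hd hd (fun q hq => S.mink_ZT_ZT hq) v
  rw [mink_comm (vecF S.ψ S.ZT p)] at h
  linarith

theorem mink_fderiv_Wc_Wc (v : Pt) :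
    mink (fderiv ℝ (vecF S.ψ S.Wc) p v) (vecF S.ψ S.Wc p) = 0 := by
  have hd := S.differentiableAt_vecF_Wc hp
  have h := mink_fderiv_add_eq_zero S.hUopen hp hd hd (fun q hq => S.hWunit q hq) v
  rw [mink_comm (vecF S.ψ S.Wc p)] at h
  linarith

theorem mink_fderiv_ZT_Wc (v : Pt) :
    mink (fderiv ℝ (vecF S.ψ S.ZT) p v) (vecF S.ψ S.Wc p) =
      -mink (fderiv ℝ (vecF S.ψ S.Wc) p v) (vecF S.ψ S.ZT p) := by
  have h := mink_fderiv_add_eq_zero S.hUopen hp (S.differentiableAt_vecF_ZT hp)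
    (S.differentiableAt_vecF_Wc hp) (fun q hq => S.hWorth q hq) v
  rw [mink_comm (vecF S.ψ S.ZT p)] at h
  linarith

theorem mink_fderiv_ZT_Zperp (v : Pt) :
    mink (fderiv ℝ (vecF S.ψ S.ZT) p v) (S.Zperp p) = 0 := by
  have h := mink_fderiv_add_eq_zero S.hUopen hp (differentiableAt_const S.Z)
    (S.differentiableAt_vecF_ZT hp) (fun q hq => (S.mink_Z hq _).trans (S.mink_ZT_ZT hq)) v
  have h' := S.mink_fderiv_ZT_ZT hp v
  rw [mink_comm S.Z] at h
  simp only [fderiv_fun_const, Pi.zero_apply, zero_apply] at h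
  have h0 : mink 0 (vecF S.ψ S.ZT p) = 0 := by simp [mink]
  rw [h0] at h
  change mink _ (S.Z - vecF S.ψ S.ZT p) = 0
  rw [mink_sub_right]
  linarith

theorem mink_fderiv_Wc_Zperp (v : Pt) :
    mink (fderiv ℝ (vecF S.ψ S.Wc) p v) (S.Zperp p) =
      mink (fderiv ℝ (vecF S.ψ S.ZT) p v) (vecF S.ψ S.Wc p) := by
  have h := mink_fderiv_add_eq_zero S.hUopen hp (differentiableAt_const S.Z)
    (S.differentiableAt_vecF_Wc hp) (fun q hq => (S.mink_Z hq _).trans (S.hWorth q hq)) v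
  rw [mink_comm S.Z] at h
  simp only [fderiv_fun_const, Pi.zero_apply, zero_apply] at h
  have h0 : mink 0 (vecF S.ψ S.Wc p) = 0 := by simp [mink]
  rw [h0] at h
  rw [S.mink_fderiv_ZT_Wc hp]
  change mink _ (S.Z - vecF S.ψ S.ZT p) = _
  rw [mink_sub_right]
  linarith

theorem Dflat_ZT_Wc_sub_Dflat_Wc_ZT :
    Dflat S.ZT (vecF S.ψ S.Wc) p - Dflat S.Wc (vecF S.ψ S.ZT) p =
      fderiv ℝ S.ψ p (lieB S.ZT S.Wc p) :=
  Dflat_vecF_sub_Dflat_vecF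
    ((S.hψ.contDiffAt (S.hUopen.mem_nhds hp)).of_le (WithTop.coe_le_coe.2 (le_top : (2 : ℕ∞) ≤ ⊤)))
    (S.differentiableAt_of_contDiffOn S.hZTsmooth hp)
    (S.differentiableAt_of_contDiffOn S.hWsmooth hp)

/-- `⟨∇_{Z^⊤} Z^⊤, W⟩ = 0`. -/
theorem mink_fderiv_ZT_apply_ZT_Wc :
    mink (fderiv ℝ (vecF S.ψ S.ZT) p (S.ZT p)) (vecF S.ψ S.Wc p) = 0 := by
  have h := S.hZTtangentpart p hp (lieB S.ZT S.Wc p)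
  rw [← S.Dflat_ZT_Wc_sub_Dflat_Wc_ZT hp, mink_sub_right, mink_comm,
    mink_comm _ (Dflat S.Wc _ p)] at h
  have h1 : mink (Dflat S.Wc (vecF S.ψ S.ZT) p) (S.Z - fderiv ℝ S.ψ p (S.ZT p)) = 0 :=
    S.mink_fderiv_ZT_Zperp hp (S.Wc p)
  rw [h1, sub_zero] at h
  rw [← S.mink_fderiv_Wc_Zperp hp]
  exact h

theorem afun_eq : S.afun p = mink (fderiv ℝ (vecF S.ψ S.ZT) p (S.Wc p)) (vecF S.ψ S.Wc p) := by
  have h := S.hZTtangentpart p hp (S.conn S.Wc S.Wc p)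
  rw [mink_comm] at h
  rw [← S.mink_fderiv_Wc_Zperp hp]
  simp only [afun, B, sff, mink_sub_left]
  change _ - mink (fderiv ℝ S.ψ p (S.conn S.Wc S.Wc p)) (S.Z - fderiv ℝ S.ψ p (S.ZT p)) = _
  rw [h, sub_zero]
  rfl

theorem conn_ZT (X : Pt → Pt) : S.conn X S.ZT p =
    mink (fderiv ℝ (vecF S.ψ S.ZT) p (X p)) (vecF S.ψ S.Wc p) • S.Wc p := by
  have h := mink_vecF_conn (S.hconn X S.ZT p hp (S.differentiableAt_vecF_ZT hp))
  have h1 := h (S.ZT p)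
  have h2 := h (S.Wc p)
  have h3 := S.eq_mink_smul_add_mink_smul hp (S.conn X S.ZT p)
  have h4 := S.mink_fderiv_ZT_ZT hp (X p)
  simp only [vecF] at h1 h2 h3 h4 ⊢
  rw [h1, h2, h4, zero_smul, zero_add] at h3
  exact h3

theorem differentiableAt_afun : DifferentiableAt ℝ S.afun p := by
  have h : S.afun =ᶠ[nhds p] fun q =>
      mink (fderiv ℝ (vecF S.ψ S.ZT) q (S.Wc q)) (vecF S.ψ S.Wc q) :=
    Filter.eventually_of_mem (S.hUopen.mem_nhds hp) fun q hq => S.afun_eq hq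
  refine DifferentiableAt.congr_of_eventuallyEq ?_ h
  refine DifferentiableAt.mink ?_ (S.differentiableAt_vecF_Wc hp)
  exact S.differentiableAt_of_contDiffOn
    (((S.contDiffOn_vecF S.hZTsmooth).fderiv_of_isOpen S.hUopen (by simp)).clm_apply S.hWsmooth) hp

theorem vecF_conn_ZT_ZT : vecF S.ψ (S.conn S.ZT S.ZT) =ᶠ[nhds p] fun _ => 0 :=
  Filter.eventually_of_mem (S.hUopen.mem_nhds hp) fun q hq => by
    change fderiv ℝ S.ψ q _ = _
    rw [S.conn_ZT hq, S.mink_fderiv_ZT_apply_ZT_Wc hq, zero_smul, map_zero]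

theorem vecF_conn_Wc_ZT :
    vecF S.ψ (S.conn S.Wc S.ZT) =ᶠ[nhds p] fun q => S.afun q • vecF S.ψ S.Wc q :=
  Filter.eventually_of_mem (S.hUopen.mem_nhds hp) fun q hq => by
    change fderiv ℝ S.ψ q _ = _
    rw [S.conn_ZT hq, ← S.afun_eq hq, map_smul]
    rfl

theorem mink_conn_Wc_conn_ZT_ZT :
    mink (fderiv ℝ S.ψ p (S.conn S.Wc (S.conn S.ZT S.ZT) p)) (fderiv ℝ S.ψ p (S.Wc p)) = 0 := by
  have hV := S.vecF_conn_ZT_ZT hp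
  rw [mink_vecF_conn (S.hconn _ _ p hp
    ((differentiableAt_const _).congr_of_eventuallyEq hV)), hV.fderiv_eq]
  simp [mink]

theorem mink_conn_ZT_conn_Wc_ZT :
    mink (fderiv ℝ S.ψ p (S.conn S.ZT (S.conn S.Wc S.ZT) p)) (fderiv ℝ S.ψ p (S.Wc p)) =
      fderiv ℝ S.afun p (S.ZT p) := by
  have hV := S.vecF_conn_Wc_ZT hp
  have ha := S.differentiableAt_afun hp
  have hW := S.differentiableAt_vecF_Wc hp
  have h1 := S.mink_fderiv_Wc_Wc hp (S.ZT p)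
  have h2 : mink (vecF S.ψ S.Wc p) (vecF S.ψ S.Wc p) = 1 := S.hWunit p hp
  rw [mink_vecF_conn (S.hconn _ _ p hp ((ha.smul hW).congr_of_eventuallyEq hV)), hV.fderiv_eq,
    fderiv_fun_smul ha hW]
  change mink (S.afun p • fderiv ℝ (vecF S.ψ S.Wc) p (S.ZT p) +
    fderiv ℝ S.afun p (S.ZT p) • vecF S.ψ S.Wc p) (vecF S.ψ S.Wc p) = _
  rw [mink_add_left, mink_smul_left, mink_smul_left, h1, h2]
  ring

theorem mink_conn_lieB_ZT :
    mink (fderiv ℝ S.ψ p (S.conn (lieB S.ZT S.Wc) S.ZT p)) (fderiv ℝ S.ψ p (S.Wc p)) =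
      -S.afun p ^ 2 := by
  have h1 : mink (fderiv ℝ S.ψ p (lieB S.ZT S.Wc p)) (vecF S.ψ S.Wc p) = -S.afun p := by
    rw [← S.Dflat_ZT_Wc_sub_Dflat_Wc_ZT hp, mink_sub_left, S.afun_eq hp]
    simp only [Dflat, S.mink_fderiv_Wc_Wc hp, zero_sub]
  rw [mink_vecF_conn (S.hconn _ _ p hp (S.differentiableAt_vecF_ZT hp)),
    S.eq_mink_smul_add_mink_smul hp (lieB S.ZT S.Wc p), h1]
  change mink _ (vecF S.ψ S.Wc p) = _
  rw [map_add, map_smul, map_smul, mink_add_left, mink_smul_left, mink_smul_left,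
    S.mink_fderiv_ZT_apply_ZT_Wc hp, ← S.afun_eq hp]
  ring

end

end CNND

/-- The Gauss curvature of `M` is given by `K = −Z^⊤(a) − a²`. -/
theorem cnnd_gauss_curvature_formula (S : CNND) :
    ∀ p ∈ S.U, S.Kfun p = -(fderiv ℝ S.afun p (S.ZT p)) - S.afun p ^ 2 := by
  intro p hp
  simp only [CNND.Kfun, curvR, map_add, map_sub, mink_add_left, mink_sub_left]
  rw [S.mink_conn_Wc_conn_ZT_ZT hp, S.mink_conn_ZT_conn_Wc_ZT hp, S.mink_conn_lieB_ZT hp]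
  ring

end
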